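/- Let X and Y be real symmetric positive-definite n×n matrices and define c(A) = trace(XA)·trace(YA⁻¹). Then c attains its minimum on the set 𝒜₁ = { A : A real symmetric positive definite and λ_min(A) = 1 }; that is, there exists A* ∈ 𝒜₁ with c(A*) ≤ c(A) for all A ∈ 𝒜₁. -/

import Mathlib

open Matrix

lemma aux_trace_mul_nonneg {n : ℕ} {P Q : Matrix (Fin n) (Fin n) ℝ}
    (hP : P.PosSemidef) (hQ : Q.PosSemidef) : 0 ≤ (P * Q).trace := by
  open scoped MatrixOrder in
  obtain ⟨C, rfl⟩ := CStarAlgebra.nonneg_iff_eq_star_mul_self.mp hQ.nonneg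
  have h := (hP.conjTranspose_mul_mul_same Cᴴ).trace_nonneg
  rw [conjTranspose_conjTranspose, Matrix.trace_mul_cycle, Matrix.trace_mul_comm] at h
  exact h

lemma aux_shift {n : ℕ} {A : Matrix (Fin n) (Fin n) ℝ} (hA : A.IsHermitian) (c : ℝ) :
    (A - c • (1 : Matrix (Fin n) (Fin n) ℝ)).PosSemidef ↔ ∀ i, c ≤ hA.eigenvalues i := by
  have hH : (A - c • (1 : Matrix (Fin n) (Fin n) ℝ)).IsHermitian := by
    apply hA.sub
    simp [Matrix.IsHermitian]
  rw [posSemidef_iff_isHermitian_and_spectrum_nonneg, ← Algebra.algebraMap_eq_smul_one,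
    ← spectrum.sub_singleton_eq, hA.spectrum_real_eq_range_eigenvalues,
    Algebra.algebraMap_eq_smul_one]
  constructor
  · rintro ⟨-, h⟩ i
    have := @h (hA.eigenvalues i - c) (Set.sub_mem_sub ⟨i, rfl⟩ rfl)
    simpa using this
  · intro h
    refine ⟨hH, ?_⟩
    rintro _ ⟨_, ⟨i, rfl⟩, _, rfl, rfl⟩
    simpa using h i

lemma aux_char {n : ℕ} [NeZero n] {A : Matrix (Fin n) (Fin n) ℝ} (hA : A.IsHermitian) :
    (⨅ i, hA.eigenvalues i) = 1 ↔
      (A - 1).PosSemidef ∧ (1 - A).det = 0 := by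
  have h1 := aux_shift hA 1
  rw [one_smul] at h1
  have h2 : (1 - A).det = 0 ↔ ∃ i, hA.eigenvalues i = 1 := by
    have : (1 : ℝ) ∈ spectrum ℝ A ↔ (1 - A).det = 0 := by
      rw [spectrum.mem_iff, Matrix.isUnit_iff_isUnit_det, map_one, isUnit_iff_ne_zero, not_not]
    rw [← this, hA.spectrum_real_eq_range_eigenvalues, Set.mem_range]
  rw [h1, h2]
  have hb : BddBelow (Set.range hA.eigenvalues) := (Set.finite_range _).bddBelow
  constructor
  · intro h
    refine ⟨fun i => h ▸ ciInf_le hb i, ?_⟩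
    obtain ⟨i, hi⟩ := exists_eq_ciInf_of_finite (f := hA.eigenvalues)
    exact ⟨i, hi.trans h⟩
  · rintro ⟨h, i, hi⟩
    exact le_antisymm (hi ▸ ciInf_le hb i) (le_ciInf h)

lemma aux_lower {n : ℕ} [NeZero n] {X : Matrix (Fin n) (Fin n) ℝ} (hX : X.PosDef) :
    ∃ ε > 0, ∀ P : Matrix (Fin n) (Fin n) ℝ, P.PosSemidef → ε * P.trace ≤ (X * P).trace := by
  obtain ⟨i, hi⟩ := exists_eq_ciInf_of_finite (f := hX.1.eigenvalues)
  refine ⟨hX.1.eigenvalues i, hX.eigenvalues_pos i, fun P hP => ?_⟩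
  have h := (aux_shift hX.1 (hX.1.eigenvalues i)).2
    (fun j => hi ▸ ciInf_le (Set.finite_range _).bddBelow j)
  have := aux_trace_mul_nonneg h hP
  rw [sub_mul, Matrix.trace_sub, smul_mul_assoc, one_mul, Matrix.trace_smul, smul_eq_mul] at this
  linarith

lemma aux_posDef {n : ℕ} {A : Matrix (Fin n) (Fin n) ℝ} (h : (A - 1).PosSemidef) : A.PosDef := by
  have := Matrix.PosDef.one.add_posSemidef h
  rwa [add_sub_cancel] at this

lemma aux_inv_trace {n : ℕ} {A : Matrix (Fin n) (Fin n) ℝ}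
    (hA : A.PosDef) (hd : (1 - A).det = 0) : 1 ≤ (A⁻¹).trace := by
  have hu : IsUnit A.det := (Matrix.isUnit_iff_isUnit_det _).1 hA.isUnit
  have hd' : (1 - A⁻¹).det = 0 := by
    have : 1 - A⁻¹ = -((1 - A) * A⁻¹) := by
      rw [sub_mul, Matrix.mul_nonsing_inv _ hu]; simp
    rw [this, Matrix.det_neg, Matrix.det_mul, hd]; simp
  have hP := hA.inv
  have hs : (1 : ℝ) ∈ spectrum ℝ A⁻¹ := by
    rw [spectrum.mem_iff, Matrix.isUnit_iff_isUnit_det, map_one, isUnit_iff_ne_zero, not_not]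
    exact hd'
  rw [hP.1.spectrum_real_eq_range_eigenvalues] at hs
  obtain ⟨i, hi⟩ := hs
  rw [hP.1.trace_eq_sum_eigenvalues, ← hi]
  exact Finset.single_le_sum (f := fun i => hP.1.eigenvalues i)
    (fun j _ => (hP.eigenvalues_pos j).le) (Finset.mem_univ i)

lemma aux_entry {n : ℕ} {A : Matrix (Fin n) (Fin n) ℝ}
    (hA : A.PosSemidef) (i j : Fin n) : |A i j| ≤ A.trace := by
  have hd : ∀ i, A i i ≤ A.trace := fun i =>
    Finset.single_le_sum (f := fun i => A i i)
      (fun j _ => hA.diag_nonneg) (Finset.mem_univ i)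
  have hs : A j i = A i j := by simpa using hA.1.apply i j
  have key : ∀ s : ℝ, 0 ≤ A i i + s * A i j + s * A j i + s * s * A j j := by
    intro s
    have := hA.dotProduct_mulVec_nonneg (Pi.single i 1 + s • Pi.single j 1)
    simp [Matrix.mulVec_add, Matrix.mulVec_smul, add_dotProduct, dotProduct_add] at this
    linarith
  have h1 := key 1
  have h2 := key (-1)
  have := hd i
  have := hd j
  rw [abs_le]
  constructor <;> linarith

lemma aux_closed {n : ℕ} : IsClosed {A : Matrix (Fin n) (Fin n) ℝ | (A - 1).PosSemidef} := by
  have : {A : Matrix (Fin n) (Fin n) ℝ | (A - 1).PosSemidef} =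
      {A | (A - 1)ᴴ = A - 1} ∩ ⋂ x : Fin n → ℝ, {A | 0 ≤ star x ⬝ᵥ ((A - 1) *ᵥ x)} := by
    ext A
    simp [posSemidef_iff_dotProduct_mulVec, Matrix.IsHermitian]
  rw [this]
  refine IsClosed.inter (isClosed_eq (by fun_prop) (by fun_prop)) (isClosed_iInter fun x => ?_)
  exact isClosed_le continuous_const (by fun_prop)

/-- `c(A) = trace(X*A) * trace(Y*A⁻¹)` attains its minimum on the set
`𝒜₁ = { A : A real symmetric positive definite with λ_min(A) = 1 }`. -/
theorem stmt12 {n : ℕ} [NeZero n] (X Y : Matrix (Fin n) (Fin n) ℝ)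
    (hX : X.PosDef) (hY : Y.PosDef) :
    ∃ A : Matrix (Fin n) (Fin n) ℝ, ∃ hA : A.PosDef, (⨅ i, hA.1.eigenvalues i) = 1 ∧
      ∀ B : Matrix (Fin n) (Fin n) ℝ, ∀ hB : B.PosDef, (⨅ i, hB.1.eigenvalues i) = 1 →
        (X * A).trace * (Y * A⁻¹).trace ≤ (X * B).trace * (Y * B⁻¹).trace := by
  obtain ⟨ε, hε, hXl⟩ := aux_lower hX
  obtain ⟨δ, hδ, hYl⟩ := aux_lower hY
  set f : Matrix (Fin n) (Fin n) ℝ → ℝ := fun A => (X * A).trace * (Y * A⁻¹).trace with hf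
  set R : ℝ := max (1 : Matrix (Fin n) (Fin n) ℝ).trace (f 1 / (ε * δ)) with hR
  set K : Set (Matrix (Fin n) (Fin n) ℝ) :=
    ({A | (A - 1).PosSemidef} ∩ {A | (1 - A).det = 0}) ∩ {A | A.trace ≤ R} with hK
  have hKc : IsClosed K := by
    refine (aux_closed.inter (isClosed_eq ?_ continuous_const)).inter
      (isClosed_le ?_ continuous_const)
    · exact (continuous_const.sub continuous_id).matrix_det
    · exact continuous_id.matrix_trace
  have hKcomp : IsCompact K := by
    have hbox : IsCompact (Set.univ.pi fun _ : Fin n => Set.univ.pi fun _ : Fin n =>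
        Set.Icc (-R) R) := isCompact_univ_pi fun _ => isCompact_univ_pi fun _ => isCompact_Icc
    refine IsCompact.of_isClosed_subset (X := Matrix (Fin n) (Fin n) ℝ) hbox hKc ?_
    rintro A ⟨⟨h1, h2⟩, h3⟩ i - j -
    have := (aux_entry (aux_posDef h1).posSemidef i j).trans h3
    exact abs_le.1 this
  have h1K : (1 : Matrix (Fin n) (Fin n) ℝ) ∈ K := by
    refine ⟨⟨?_, ?_⟩, show Matrix.trace _ ≤ R from le_max_left _ _⟩
    · simpa using Matrix.PosSemidef.zero
    · simp [Matrix.det_zero]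
  have hcont : ContinuousOn f K := by
    rintro A ⟨⟨h1, h2⟩, h3⟩
    apply ContinuousAt.continuousWithinAt
    have hdet : A.det ≠ 0 := (aux_posDef h1).det_pos.ne'
    have hinv : ContinuousAt (Inv.inv : Matrix (Fin n) (Fin n) ℝ → _) A := by
      apply continuousAt_matrix_inv
      rw [Ring.inverse_eq_inv']
      exact continuousAt_inv₀ hdet
    have e1 : Continuous fun A : Matrix (Fin n) (Fin n) ℝ => (X * A).trace :=
      (continuous_const.matrix_mul continuous_id).matrix_trace
    have e2 : Continuous fun A : Matrix (Fin n) (Fin n) ℝ => (Y * A).trace :=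
      (continuous_const.matrix_mul continuous_id).matrix_trace
    exact e1.continuousAt.mul (e2.continuousAt.comp hinv)
  obtain ⟨A, hAK, hmin⟩ := hKcomp.exists_isMinOn ⟨1, h1K⟩ hcont
  have hA := aux_posDef hAK.1.1
  refine ⟨A, hA, (aux_char hA.1).2 hAK.1, fun B hB hB1 => ?_⟩
  have hBS := (aux_char hB.1).1 hB1
  by_cases hBR : B.trace ≤ R
  · exact hmin (show B ∈ K from ⟨hBS, hBR⟩)
  · push Not at hBR
    have hA1 : f A ≤ f 1 := hmin h1K
    have h3 : f 1 ≤ ε * δ * B.trace := by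
      have : f 1 / (ε * δ) ≤ B.trace := (le_max_right _ _).trans hBR.le
      rw [div_le_iff₀ (by positivity)] at this
      linarith
    have h4 := hXl B hB.posSemidef
    have h5 := hYl _ hB.inv.posSemidef
    have h6 := aux_inv_trace hB hBS.2
    have h7 : δ ≤ (Y * B⁻¹).trace := by nlinarith
    have h8 : 0 ≤ B.trace := hB.posSemidef.trace_nonneg
    have h9 : (ε * B.trace) * δ ≤ (X * B).trace * (Y * B⁻¹).trace :=
      mul_le_mul h4 h7 hδ.le ((by positivity : 0 ≤ ε * B.trace).trans h4)
    calc f A ≤ f 1 := hA1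
      _ ≤ _ := h3
      _ = (ε * B.trace) * δ := by ring
      _ ≤ _ := h9
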